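/- Let R be a right GF-closed ring with r.Gwdim(R) < ∞ and let n be a positive integer. Then the following are equivalent: (1) r.Gwdim(R) ≤ n; (2) Gfd_R(M) ≤ n for every finitely presented right R-module M; (3) Gfd_R(R/I) ≤ n for every finitely generated right ideal I of R; (4) fd_R(E) ≤ n for every injective left R-module E; (5) fd_R(E') ≤ n for every left R-module E' with finite injective dimension. -/

import Mathlib

/-!
Background definitions for D. Bennis, "Weak Gorenstein global dimensions".

Conventions.  All rings are associative with identity.  A *left* `R`-module is a type with
`[AddCommGroup M] [Module R M]`; a *right* `R`-module is a left module over the opposite ring,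
i.e. `[Module Rᵐᵒᵖ M]`.  All "right-handed" notions below are obtained by applying the
corresponding "left-handed" notion to the opposite ring `Rᵐᵒᵖ`.
-/

open MulOpposite

universe u

section Tensor

variable (S : Type u) [Ring S]

/-- The subgroup of relations defining the tensor product `A ⊗_S M` of a right `S`-module `A`
and a left `S`-module `M` over a (possibly noncommutative) ring `S`. -/
def tensorRels (A : Type u) [AddCommGroup A] [Module Sᵐᵒᵖ A]
    (M : Type u) [AddCommGroup M] [Module S M] :
    AddSubgroup (FreeAbelianGroup (A × M)) :=
  AddSubgroup.closure
    { x | (∃ a₁ a₂ m, x = FreeAbelianGroup.of (a₁ + a₂, m) - FreeAbelianGroup.of (a₁, m) -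
            FreeAbelianGroup.of (a₂, m)) ∨
          (∃ a m₁ m₂, x = FreeAbelianGroup.of (a, m₁ + m₂) - FreeAbelianGroup.of (a, m₁) -
            FreeAbelianGroup.of (a, m₂)) ∨
          (∃ (a : A) (r : S) (m : M), x = FreeAbelianGroup.of (op r • a, m) - FreeAbelianGroup.of (a, r • m)) }

/-- The tensor product `A ⊗_S M` (an abelian group) of a right `S`-module `A` and a left
`S`-module `M` over a (possibly noncommutative) ring `S`. -/
def NTensor (A : Type u) [AddCommGroup A] [Module Sᵐᵒᵖ A]
    (M : Type u) [AddCommGroup M] [Module S M] : Type u :=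
  FreeAbelianGroup (A × M) ⧸ tensorRels S A M

instance (A : Type u) [AddCommGroup A] [Module Sᵐᵒᵖ A]
    (M : Type u) [AddCommGroup M] [Module S M] : AddCommGroup (NTensor S A M) :=
  QuotientAddGroup.Quotient.addCommGroup _

namespace NTensor

variable {S}
variable {A A' : Type u} [AddCommGroup A] [Module Sᵐᵒᵖ A] [AddCommGroup A'] [Module Sᵐᵒᵖ A']
variable {M M' : Type u} [AddCommGroup M] [Module S M] [AddCommGroup M'] [Module S M']

/-- Functoriality of `A ⊗_S −` : the map `A ⊗_S M → A ⊗_S M'` induced by a linear map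
`g : M → M'` of left `S`-modules. -/
def rmap (A : Type u) [AddCommGroup A] [Module Sᵐᵒᵖ A] (g : M →ₗ[S] M') :
    NTensor S A M →+ NTensor S A M' :=
  QuotientAddGroup.map (tensorRels S A M) (tensorRels S A M') (FreeAbelianGroup.map (Prod.map id g)) (by
    simp only [tensorRels]
    refine (AddSubgroup.closure_le _).2 ?_
    rintro x (⟨a₁, a₂, m, rfl⟩ | ⟨a, m₁, m₂, rfl⟩ | ⟨a, r, m, rfl⟩) <;>
      refine SetLike.mem_coe.2 (AddSubgroup.mem_comap.2 (AddSubgroup.subset_closure ?_)) <;>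
      simp only [map_sub, map_add, map_smul, FreeAbelianGroup.map_of_apply, Prod.map_apply,
        id_eq, Set.mem_setOf_eq]
    · exact Or.inl ⟨a₁, a₂, g m, rfl⟩
    · exact Or.inr (Or.inl ⟨a, g m₁, g m₂, rfl⟩)
    · exact Or.inr (Or.inr ⟨a, r, g m, rfl⟩))

/-- Functoriality of `− ⊗_S M` : the map `A ⊗_S M → A' ⊗_S M` induced by a linear map
`f : A → A'` of right `S`-modules. -/
def lmap (M : Type u) [AddCommGroup M] [Module S M] (f : A →ₗ[Sᵐᵒᵖ] A') :
    NTensor S A M →+ NTensor S A' M :=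
  QuotientAddGroup.map (tensorRels S A M) (tensorRels S A' M) (FreeAbelianGroup.map (Prod.map f id)) (by
    simp only [tensorRels]
    refine (AddSubgroup.closure_le _).2 ?_
    rintro x (⟨a₁, a₂, m, rfl⟩ | ⟨a, m₁, m₂, rfl⟩ | ⟨a, r, m, rfl⟩) <;>
      refine SetLike.mem_coe.2 (AddSubgroup.mem_comap.2 (AddSubgroup.subset_closure ?_)) <;>
      simp only [map_sub, map_add, map_smul, FreeAbelianGroup.map_of_apply, Prod.map_apply,
        id_eq, Set.mem_setOf_eq]
    · exact Or.inl ⟨f a₁, f a₂, m, rfl⟩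
    · exact Or.inr (Or.inl ⟨f a, m₁, m₂, rfl⟩)
    · exact Or.inr (Or.inr ⟨f a, r, m, rfl⟩))

end NTensor

end Tensor

section Dims

variable (S : Type u) [Ring S]

/-- A left `S`-module `M` is *flat* if tensoring with it preserves injectivity of maps of
right `S`-modules. -/
def IsFlatMod (M : ModuleCat.{u} S) : Prop :=
  ∀ (A B : Type u) [AddCommGroup A] [Module Sᵐᵒᵖ A] [AddCommGroup B] [Module Sᵐᵒᵖ B]
    (f : A →ₗ[Sᵐᵒᵖ] B), Function.Injective f →
      Function.Injective (NTensor.lmap (↥M) f)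

/-- A left `S`-module `M` is *Gorenstein flat* if there is an exact sequence
`⋯ → F (-1) → F 0 → F 1 → ⋯` of flat left `S`-modules with `M ≅ Im (F 0 → F 1)` which stays
exact after applying `I ⊗_S −` for every injective right `S`-module `I`
(a *complete flat resolution*). -/
def IsGorensteinFlat (M : ModuleCat.{u} S) : Prop :=
  ∃ (F : ℤ → ModuleCat.{u} S) (d : ∀ n : ℤ, ↥(F n) →ₗ[S] ↥(F (n + 1))),
    (∀ n, IsFlatMod S (F n)) ∧
    (∀ n, Function.Exact (d n) (d (n + 1))) ∧
    Nonempty (↥M ≃ₗ[S] ↥(LinearMap.range (d 0))) ∧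
    (∀ (I : Type u) [AddCommGroup I] [Module Sᵐᵒᵖ I], Module.Injective Sᵐᵒᵖ I →
      ∀ n, Function.Exact (NTensor.rmap I (d n)) (NTensor.rmap I (d (n + 1))))

/-- `gflatDimLE S n M` means `Gfd_S(M) ≤ n`: there is an exact sequence
`0 → G_n → ⋯ → G_0 → M → 0` of left `S`-modules with all `G_i` Gorenstein flat. -/
def gflatDimLE : ℕ → ModuleCat.{u} S → Prop
  | 0, M => IsGorensteinFlat S M
  | n + 1, M => ∃ (K G : ModuleCat.{u} S) (ι : ↥K →ₗ[S] ↥G) (π : ↥G →ₗ[S] ↥M),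
      Function.Injective ι ∧ Function.Surjective π ∧ Function.Exact ι π ∧
      IsGorensteinFlat S G ∧ gflatDimLE n K

/-- `flatDimLE S n M` means `fd_S(M) ≤ n`: there is an exact sequence
`0 → F_n → ⋯ → F_0 → M → 0` of left `S`-modules with all `F_i` flat. -/
def flatDimLE : ℕ → ModuleCat.{u} S → Prop
  | 0, M => IsFlatMod S M
  | n + 1, M => ∃ (K F : ModuleCat.{u} S) (ι : ↥K →ₗ[S] ↥F) (π : ↥F →ₗ[S] ↥M),
      Function.Injective ι ∧ Function.Surjective π ∧ Function.Exact ι π ∧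
      IsFlatMod S F ∧ flatDimLE n K

/-- `injDimLE S n M` means `id_S(M) ≤ n`: there is an exact sequence
`0 → M → I^0 → ⋯ → I^n → 0` of left `S`-modules with all `I^i` injective. -/
def injDimLE : ℕ → ModuleCat.{u} S → Prop
  | 0, M => Module.Injective S ↥M
  | n + 1, M => ∃ (I C : ModuleCat.{u} S) (ι : ↥M →ₗ[S] ↥I) (π : ↥I →ₗ[S] ↥C),
      Function.Injective ι ∧ Function.Surjective π ∧ Function.Exact ι π ∧
      Module.Injective S ↥I ∧ injDimLE n C

/-- The Gorenstein flat dimension `Gfd_S(M) ∈ ℕ∞` of a left `S`-module `M`. -/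
noncomputable def gflatDim (M : ModuleCat.{u} S) : ℕ∞ :=
  sInf {d : ℕ∞ | ∃ n : ℕ, d = n ∧ gflatDimLE S n M}

/-- The flat dimension `fd_S(M) ∈ ℕ∞` of a left `S`-module `M`. -/
noncomputable def flatDim (M : ModuleCat.{u} S) : ℕ∞ :=
  sInf {d : ℕ∞ | ∃ n : ℕ, d = n ∧ flatDimLE S n M}

/-- The injective dimension `id_S(M) ∈ ℕ∞` of a left `S`-module `M`. -/
noncomputable def injDim (M : ModuleCat.{u} S) : ℕ∞ :=
  sInf {d : ℕ∞ | ∃ n : ℕ, d = n ∧ injDimLE S n M}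

/-- The left weak Gorenstein global dimension
`l.Gwdim(S) = sup { Gfd_S(M) | M a left S-module }`.  The right weak Gorenstein global
dimension of `S` is `gorensteinWeakGlobalDim Sᵐᵒᵖ`. -/
noncomputable def gorensteinWeakGlobalDim : ℕ∞ :=
  ⨆ M : ModuleCat.{u} S, gflatDim S M

/-- The left weak global dimension `sup { fd_S(M) | M a left S-module }`.  (By a classical
theorem it agrees with `weakGlobalDim Sᵐᵒᵖ`, and the common value is `wdim S`.) -/
noncomputable def weakGlobalDim : ℕ∞ :=
  ⨆ M : ModuleCat.{u} S, flatDim S M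

/-- The left finitistic flat dimension
`l.FFD(S) = sup { fd_S(M) | M a left S-module with fd_S(M) < ∞ }`. -/
noncomputable def finitisticFlatDim : ℕ∞ :=
  sSup {d : ℕ∞ | d ≠ ⊤ ∧ ∃ M : ModuleCat.{u} S, flatDim S M = d}

/-- The left finitistic Gorenstein flat dimension
`l.FGFD(S) = sup { Gfd_S(M) | M a left S-module with Gfd_S(M) < ∞ }`. -/
noncomputable def finitisticGFlatDim : ℕ∞ :=
  sSup {d : ℕ∞ | d ≠ ⊤ ∧ ∃ M : ModuleCat.{u} S, gflatDim S M = d}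

/-- A ring `S` is *left GF-closed* if the class of Gorenstein flat left `S`-modules is closed
under extensions.  `S` is right GF-closed iff `Sᵐᵒᵖ` is left GF-closed, and GF-closed if both. -/
def IsGFClosed : Prop :=
  ∀ (A B C : ModuleCat.{u} S) (f : ↥A →ₗ[S] ↥B) (g : ↥B →ₗ[S] ↥C),
    Function.Injective f → Function.Surjective g → Function.Exact f g →
      IsGorensteinFlat S A → IsGorensteinFlat S C → IsGorensteinFlat S B

/-- A ring `S` is *left coherent* if every finitely generated left ideal of `S` is finitely
presented (as a left `S`-module).  `S` is right coherent iff `Sᵐᵒᵖ` is left coherent. -/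
def IsLeftCoherent : Prop :=
  ∀ I : Submodule S S, I.FG → Module.FinitePresentation S ↥I

/-- A ring `S` is *left IF* if every injective left `S`-module is flat.  `S` is right IF iff
`Sᵐᵒᵖ` is left IF, and IF if both. -/
def IsLeftIF : Prop :=
  ∀ E : ModuleCat.{u} S, Module.Injective S ↥E → IsFlatMod S E

/-- A ring `S` is *left `n`-IF* if `fd_S(E) ≤ n` for every injective left `S`-module `E`.
`S` is right `n`-IF iff `Sᵐᵒᵖ` is left `n`-IF, and `n`-IF if both. -/
def IsLeftNIF (n : ℕ) : Prop :=
  ∀ E : ModuleCat.{u} S, Module.Injective S ↥E → flatDim S E ≤ (n : ℕ∞)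

/-- `Ext¹_S(T, K) = 0`, expressed by its standard characterization: every extension of `T`
by `K` (i.e. every short exact sequence `0 → K → X → T → 0`) splits. -/
def Ext1Zero (T K : ModuleCat.{u} S) : Prop :=
  ∀ (X : ModuleCat.{u} S) (ι : ↥K →ₗ[S] ↥X) (π : ↥X →ₗ[S] ↥T),
    Function.Injective ι → Function.Surjective π → Function.Exact ι π →
      ∃ ρ : ↥X →ₗ[S] ↥K, ρ.comp ι = LinearMap.id

/-- A left `S`-module `K` is *cotorsion* if `Ext¹_S(F, K) = 0` for every flat left
`S`-module `F`. -/
def IsCotorsion (K : ModuleCat.{u} S) : Prop :=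
  ∀ F : ModuleCat.{u} S, IsFlatMod S F → Ext1Zero S F K

/-- `Tor₁^S(A, T) = 0` for a right `S`-module `A` and a left `S`-module `T`, expressed by its
standard characterization: for every short exact sequence `0 → K → F → T → 0` of left
`S`-modules with `F` flat, the induced map `A ⊗_S K → A ⊗_S F` is injective. -/
def Tor1Zero (A : Type u) [AddCommGroup A] [Module Sᵐᵒᵖ A] (T : ModuleCat.{u} S) : Prop :=
  ∀ (K F : ModuleCat.{u} S) (ι : ↥K →ₗ[S] ↥F) (π : ↥F →ₗ[S] ↥T),
    IsFlatMod S F → Function.Injective ι → Function.Surjective π → Function.Exact ι π →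
      Function.Injective (NTensor.rmap A ι)

/-- A left `S`-module is *finitely presented* if it admits a presentation with finitely many
generators and relations. -/
abbrev IsFinitelyPresented (M : ModuleCat.{u} S) : Prop :=
  Module.FinitePresentation S ↥M

end Dims

section ExtVanishing

open CategoryTheory CategoryTheory.Abelian

/-- The sequence `0 → A → B → C → 0` given by `i` and `p` is exact. -/
structure IsShortExact {S : Type u} [Ring S] {A B C : Type u} [AddCommGroup A] [Module S A]
    [AddCommGroup B] [Module S B] [AddCommGroup C] [Module S C]
    (i : A →ₗ[S] B) (p : B →ₗ[S] C) : Prop where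
  inj : Function.Injective i
  surj : Function.Surjective p
  exact : Function.Exact i p

/-- `Extᵏ_S(M, N) = 0`. -/
def ExtZero (S : Type u) [Ring S] (k : ℕ) (M N : Type u) [AddCommGroup M] [Module S M]
    [AddCommGroup N] [Module S N] : Prop :=
  Subsingleton (Ext (ModuleCat.of S M) (ModuleCat.of S N) k)

variable {S : Type u} [Ring S] {A B C X : Type u} [AddCommGroup A] [Module S A]
  [AddCommGroup B] [Module S B] [AddCommGroup C] [Module S C] [AddCommGroup X] [Module S X]
  {i : A →ₗ[S] B} {p : B →ₗ[S] C}

namespace IsShortExact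

/-- The short complex in `ModuleCat S` given by a short exact sequence of modules. -/
noncomputable abbrev shortComplex (h : IsShortExact i p) : ShortComplex (ModuleCat.{u} S) :=
  ShortComplex.mk (ModuleCat.ofHom i) (ModuleCat.ofHom p)
    (by rw [← ModuleCat.ofHom_comp, h.exact.linearMap_comp_eq_zero]; rfl)

theorem shortExact_shortComplex (h : IsShortExact i p) : h.shortComplex.ShortExact where
  exact := (ShortComplex.ShortExact.moduleCat_exact_iff_function_exact _).2 h.exact
  mono_f := (ModuleCat.mono_iff_injective _).2 h.inj
  epi_g := (ModuleCat.epi_iff_surjective _).2 h.surj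

theorem extZero_left_succ (h : IsShortExact i p) {k : ℕ} (hC : ExtZero S k X C)
    (hB : ExtZero S (k + 1) X B) : ExtZero S (k + 1) X A := by
  refine subsingleton_of_forall_eq 0 fun x => ?_
  obtain ⟨y, rfl⟩ := Ext.covariant_sequence_exact₁ _ h.shortExact_shortComplex x
    (hB.elim _ _) (n₀ := k) rfl
  have hy : y = 0 := hC.elim _ _
  rw [hy]
  exact Ext.zero_comp ..

theorem extZero_right (h : IsShortExact i p) {k : ℕ} (hB : ExtZero S k X B)
    (hA : ExtZero S (k + 1) X A) : ExtZero S k X C := by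
  refine subsingleton_of_forall_eq 0 fun x => ?_
  obtain ⟨y, rfl⟩ := Ext.covariant_sequence_exact₃ _ h.shortExact_shortComplex x
    (n₁ := k + 1) rfl (hA.elim _ _)
  have hy : y = 0 := hB.elim _ _
  rw [hy]
  exact Ext.zero_comp ..

theorem exists_lift (h : IsShortExact i p) (hA : ExtZero S 1 X A) (g : X →ₗ[S] C) :
    ∃ f : X →ₗ[S] B, p.comp f = g := by
  obtain ⟨y, hy⟩ := Ext.covariant_sequence_exact₃ _ h.shortExact_shortComplex
    (Ext.mk₀ (ModuleCat.ofHom g)) (n₁ := 1) rfl (hA.elim _ _)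
  obtain ⟨y, rfl⟩ := Ext.addEquiv₀.symm.surjective y
  have hy' := Ext.addEquiv₀.symm.injective ((Ext.mk₀_comp_mk₀ _ _).symm.trans hy)
  exact ⟨y.hom, congrArg ModuleCat.Hom.hom hy'⟩

theorem extZero_one_of_exists_lift (h : IsShortExact i p) (hB : ExtZero S 1 X B)
    (hl : ∀ g : X →ₗ[S] C, ∃ f : X →ₗ[S] B, p.comp f = g) : ExtZero S 1 X A := by
  refine subsingleton_of_forall_eq 0 fun x => ?_
  obtain ⟨y, rfl⟩ := Ext.covariant_sequence_exact₁ _ h.shortExact_shortComplex x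
    (hB.elim _ _) (n₀ := 0) rfl
  obtain ⟨y, rfl⟩ := Ext.addEquiv₀.symm.surjective y
  obtain ⟨f, hf⟩ := hl y.hom
  have : y = ModuleCat.ofHom f ≫ h.shortComplex.g := by
    ext1; exact hf.symm
  subst this
  have e := Ext.mk₀_comp_mk₀ (ModuleCat.ofHom f) h.shortComplex.g
  change Ext.comp (Ext.mk₀ _) _ _ = 0
  rw [← e, Ext.comp_assoc_of_second_deg_zero, ShortComplex.ShortExact.comp_extClass,
    Ext.comp_zero]

theorem extZero_sub (h : IsShortExact i p) {k : ℕ} (hB : ExtZero S k B X)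
    (hC : ExtZero S (k + 1) C X) : ExtZero S k A X := by
  refine subsingleton_of_forall_eq 0 fun x => ?_
  obtain ⟨y, rfl⟩ := Ext.contravariant_sequence_exact₁ h.shortExact_shortComplex _ x
    (n₁ := k + 1) (add_comm _ _) (hC.elim _ _)
  have hy : y = 0 := hB.elim _ _
  rw [hy]
  exact Ext.comp_zero ..

theorem extZero_quotient_succ (h : IsShortExact i p) {k : ℕ} (hA : ExtZero S k A X)
    (hB : ExtZero S (k + 1) B X) : ExtZero S (k + 1) C X := by
  refine subsingleton_of_forall_eq 0 fun x => ?_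
  obtain ⟨y, rfl⟩ := Ext.contravariant_sequence_exact₃ h.shortExact_shortComplex _ x
    (hB.elim _ _) (n₀ := k) (add_comm _ _)
  have hy : y = 0 := hA.elim _ _
  rw [hy]
  exact Ext.comp_zero ..

theorem extZero_middle (h : IsShortExact i p) {k : ℕ} (hA : ExtZero S k A X)
    (hC : ExtZero S k C X) : ExtZero S k B X := by
  refine subsingleton_of_forall_eq 0 fun x => ?_
  obtain ⟨y, rfl⟩ := Ext.contravariant_sequence_exact₂ h.shortExact_shortComplex _ x
    (hA.elim _ _)
  have hy : y = 0 := hC.elim _ _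
  rw [hy]
  exact Ext.comp_zero ..

theorem exists_extension (h : IsShortExact i p) (hC : ExtZero S 1 C X) (g : A →ₗ[S] X) :
    ∃ f : B →ₗ[S] X, f.comp i = g := by
  obtain ⟨y, hy⟩ := Ext.contravariant_sequence_exact₁ h.shortExact_shortComplex _
    (Ext.mk₀ (ModuleCat.ofHom g)) (n₁ := 1) rfl (hC.elim _ _)
  obtain ⟨y, rfl⟩ := Ext.addEquiv₀.symm.surjective y
  have hy' := Ext.addEquiv₀.symm.injective ((Ext.mk₀_comp_mk₀ _ _).symm.trans hy)
  exact ⟨y.hom, congrArg ModuleCat.Hom.hom hy'⟩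

theorem extZero_one_of_exists_extension (h : IsShortExact i p) (hB : ExtZero S 1 B X)
    (hl : ∀ g : A →ₗ[S] X, ∃ f : B →ₗ[S] X, f.comp i = g) : ExtZero S 1 C X := by
  refine subsingleton_of_forall_eq 0 fun x => ?_
  obtain ⟨y, rfl⟩ := Ext.contravariant_sequence_exact₃ h.shortExact_shortComplex _ x
    (hB.elim _ _) (n₀ := 0) rfl
  obtain ⟨y, rfl⟩ := Ext.addEquiv₀.symm.surjective y
  obtain ⟨f, hf⟩ := hl y.hom
  have : y = h.shortComplex.f ≫ ModuleCat.ofHom f := by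
    ext1; exact hf.symm
  subst this
  have e := Ext.mk₀_comp_mk₀ h.shortComplex.f (ModuleCat.ofHom f)
  change Ext.comp _ (Ext.mk₀ _) _ = 0
  rw [← e, ← Ext.comp_assoc_of_second_deg_zero, ShortComplex.ShortExact.extClass_comp,
    Ext.zero_comp]

end IsShortExact

theorem extZero_of_injective [Module.Injective S B] (k : ℕ) : ExtZero S (k + 1) A B :=
  have : Injective (ModuleCat.of S B) := Module.injective_object_of_injective_module S B
  Ext.subsingleton_of_injective _ _ _

theorem extZero_of_projective [Module.Projective S A] (k : ℕ) : ExtZero S (k + 1) A B :=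
  have : Projective (ModuleCat.of S A) := ModuleCat.projective_of_categoryTheory_projective _
  Ext.subsingleton_of_projective _ _ _

theorem ExtZero.of_linearEquiv (e : A ≃ₗ[S] B) {k : ℕ} (h : ExtZero S (k + 1) A X) :
    ExtZero S (k + 1) B X :=
  have he : IsShortExact (e : A →ₗ[S] B) (0 : B →ₗ[S] PUnit.{u + 1}) :=
    ⟨e.injective, fun _ => ⟨0, rfl⟩, fun b => ⟨fun _ => e.surjective b, fun _ => rfl⟩⟩
  he.extZero_middle h (extZero_of_projective k)

theorem isShortExact_mkQ (N : Submodule S A) : IsShortExact N.subtype N.mkQ :=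
  ⟨N.injective_subtype, N.mkQ_surjective, LinearMap.exact_subtype_mkQ N⟩

theorem isShortExact_ker (p : B →ₗ[S] C) (hp : Function.Surjective p) :
    IsShortExact (LinearMap.ker p).subtype p :=
  ⟨Submodule.injective_subtype _, hp, LinearMap.exact_subtype_ker_map p⟩

theorem isShortExact_range_mkQ (i : A →ₗ[S] B) (hi : Function.Injective i) :
    IsShortExact i (LinearMap.range i).mkQ :=
  ⟨hi, Submodule.mkQ_surjective _, LinearMap.exact_map_mkQ_range i⟩

theorem exists_isShortExact_free (S : Type u) [Ring S] (A : Type u) [AddCommGroup A]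
    [Module S A] : ∃ (K : ModuleCat.{u} S) (i : K →ₗ[S] (A →₀ S)) (p : (A →₀ S) →ₗ[S] A),
      IsShortExact i p :=
  ⟨ModuleCat.of S (LinearMap.ker (Finsupp.linearCombination S (id : A → A))), _, _,
    isShortExact_ker _ (Finsupp.linearCombination_surjective S Function.surjective_id)⟩

end ExtVanishing

section Characters

variable {X Y Z : Type*} [AddCommGroup X] [AddCommGroup Y] [AddCommGroup Z]

theorem exists_character_comp_eq (v : Y →+ Z) (c : CharacterModule Y)
    (hc : ∀ y, v y = 0 → c y = 0) : ∃ c' : CharacterModule Z, ∀ y, c' (v y) = c y := by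
  obtain ⟨c', hc'⟩ := (Module.Baer.of_divisible (AddCircle (1 : ℚ))).extension_property_addMonoidHom
    (QuotientAddGroup.kerLift v) (QuotientAddGroup.kerLift_injective v)
    (QuotientAddGroup.lift v.ker c fun y hy => hc y hy)
  exact ⟨c', fun y => DFunLike.congr_fun hc' (y : Y ⧸ v.ker)⟩

theorem exact_iff_forall_character {u : X →+ Y} {v : Y →+ Z} (huv : ∀ x, v (u x) = 0) :
    Function.Exact u v ↔ ∀ c : CharacterModule Y, (∀ x, c (u x) = 0) →
      ∃ c' : CharacterModule Z, ∀ y, c' (v y) = c y := by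
  refine ⟨fun h c hc => exists_character_comp_eq v c fun y hy => ?_, fun h y => ⟨fun hy => ?_, ?_⟩⟩
  · obtain ⟨x, rfl⟩ := (h y).1 hy
    exact hc x
  · by_contra hr
    have hne : (y : Y ⧸ u.range) ≠ 0 := fun h0 => hr ((QuotientAddGroup.eq_zero_iff y).1 h0)
    obtain ⟨c, hc⟩ := CharacterModule.exists_character_apply_ne_zero_of_ne_zero hne
    obtain ⟨c', hc'⟩ := h (AddMonoidHom.comp c (QuotientAddGroup.mk' u.range)) fun x => by
      have hx : QuotientAddGroup.mk' u.range (u x) = 0 :=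
        (QuotientAddGroup.eq_zero_iff _).2 ⟨x, rfl⟩
      exact (congrArg c hx).trans (map_zero c)
    refine hc ((hc' y).symm.trans ?_)
    rw [hy, map_zero]
  · rintro ⟨x, rfl⟩
    exact huv x

theorem injective_iff_forall_character {v : Y →+ Z} :
    Function.Injective v ↔ ∀ c : CharacterModule Y,
      ∃ c' : CharacterModule Z, ∀ y, c' (v y) = c y := by
  refine ⟨fun h c => exists_character_comp_eq v c fun y hy => ?_, fun h => ?_⟩
  · rw [(injective_iff_map_eq_zero v).1 h y hy, map_zero]
  · refine (injective_iff_map_eq_zero v).2 fun y hy =>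
      CharacterModule.eq_zero_of_character_apply fun c => ?_
    obtain ⟨c', hc'⟩ := h c
    rw [← hc', hy, map_zero]

end Characters

namespace NTensor

variable {S : Type u} [Ring S] {A A' : Type u} [AddCommGroup A] [Module Sᵐᵒᵖ A]
  [AddCommGroup A'] [Module Sᵐᵒᵖ A'] {M M' : Type u} [AddCommGroup M] [Module S M]
  [AddCommGroup M'] [Module S M'] {X : Type*} [AddCommGroup X]

variable (S) in
/-- The pure tensor `a ⊗ m`. -/
def tmul (a : A) (m : M) : NTensor S A M :=
  QuotientAddGroup.mk' (tensorRels S A M) (FreeAbelianGroup.of (a, m))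

theorem add_tmul (a₁ a₂ : A) (m : M) : tmul S (a₁ + a₂) m = tmul S a₁ m + tmul S a₂ m := by
  rw [← sub_eq_zero, ← sub_sub]
  exact (QuotientAddGroup.eq_zero_iff _).2
    (AddSubgroup.subset_closure (Or.inl ⟨a₁, a₂, m, rfl⟩))

theorem tmul_add (a : A) (m₁ m₂ : M) : tmul S a (m₁ + m₂) = tmul S a m₁ + tmul S a m₂ := by
  rw [← sub_eq_zero, ← sub_sub]
  exact (QuotientAddGroup.eq_zero_iff _).2
    (AddSubgroup.subset_closure (Or.inr (Or.inl ⟨a, m₁, m₂, rfl⟩)))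

theorem op_smul_tmul (a : A) (r : S) (m : M) : tmul S (op r • a) m = tmul S a (r • m) := by
  rw [← sub_eq_zero]
  exact (QuotientAddGroup.eq_zero_iff _).2
    (AddSubgroup.subset_closure (Or.inr (Or.inr ⟨a, r, m, rfl⟩)))

/-- The homomorphism induced by a balanced biadditive map. -/
def lift (f : A →+ M →+ X) (hf : ∀ a (r : S) m, f (op r • a) m = f a (r • m)) : NTensor S A M →+ X :=
  QuotientAddGroup.lift (tensorRels S A M) (FreeAbelianGroup.lift fun x => f x.1 x.2) <| by
    refine (AddSubgroup.closure_le _).2 ?_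
    rintro x (⟨a₁, a₂, m, rfl⟩ | ⟨a, m₁, m₂, rfl⟩ | ⟨a, r, m, rfl⟩) <;>
      simp [hf]

@[simp]
theorem lift_tmul (f : A →+ M →+ X) (hf : ∀ a (r : S) m, f (op r • a) m = f a (r • m)) (a : A) (m : M) :
    lift f hf (tmul S a m) = f a m :=
  FreeAbelianGroup.lift_apply_of _ _

@[simp]
theorem lmap_tmul (f : A →ₗ[Sᵐᵒᵖ] A') (a : A) (m : M) :
    lmap M f (tmul S a m) = tmul S (f a) m :=
  rfl

@[simp]
theorem rmap_tmul (g : M →ₗ[S] M') (a : A) (m : M) :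
    rmap A g (tmul S a m) = tmul S a (g m) :=
  rfl

theorem induction_on {P : NTensor S A M → Prop} (x : NTensor S A M)
    (htmul : ∀ a m, P (tmul S a m)) (hadd : ∀ x y, P x → P y → P (x + y)) : P x := by
  have hzero : (0 : NTensor S A M) = tmul S 0 0 := by
    have h := add_tmul (S := S) (0 : A) 0 (0 : M)
    rwa [add_zero, left_eq_add, eq_comm] at h
  have hneg (a : A) (m : M) : -tmul S a m = tmul S (-a) m := by
    refine neg_eq_of_add_eq_zero_right ?_
    have h := add_tmul (S := S) a 0 m
    rw [add_zero, left_eq_add] at h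
    rw [← add_tmul, add_neg_cancel, h]
  obtain ⟨x, rfl⟩ := QuotientAddGroup.mk'_surjective _ x
  induction x using FreeAbelianGroup.induction_on with
  | zero => rw [map_zero]; exact hzero ▸ htmul 0 0
  | of x => exact htmul x.1 x.2
  | neg x _ => rw [map_neg]; exact (hneg x.1 x.2).symm ▸ htmul _ _
  | add x y hx hy => rw [map_add]; exact hadd _ _ hx hy

theorem addMonoidHom_ext {f g : NTensor S A M →+ X} (h : ∀ a m, f (tmul S a m) = g (tmul S a m)) :
    f = g := by
  ext x
  induction x using induction_on with
  | htmul a m => exact h a m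
  | hadd x y hx hy => rw [map_add, map_add, hx, hy]

end NTensor

section CharacterDual

variable {R : Type u} [Ring R] {E E' E'' : Type u} [AddCommGroup E] [Module R E]
  [AddCommGroup E'] [Module R E'] [AddCommGroup E''] [Module R E'']

/-- The character module of a left `R`-module is a right `R`-module. -/
instance CharacterModule.instModuleMulOpposite : Module Rᵐᵒᵖ (CharacterModule E) where
  smul r c := AddMonoidHom.comp c (DistribSMul.toAddMonoidHom E (unop r))
  one_smul c := by ext x; exact congrArg c (one_smul R x)
  mul_smul r s c := by ext x; exact congrArg c (mul_smul (unop s) (unop r) x)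
  smul_zero _ := rfl
  smul_add _ _ _ := rfl
  add_smul r s c := by
    ext x; exact (congrArg c (add_smul (unop r) (unop s) x)).trans (map_add c _ _)
  zero_smul c := by ext x; exact (congrArg c (zero_smul R x)).trans (map_zero c)

theorem CharacterModule.op_smul_apply (r : Rᵐᵒᵖ) (c : CharacterModule E) (x : E) :
    (r • c) x = c (unop r • x) :=
  rfl

/-- The map of right modules induced on character modules by a map of left modules. -/
def characterMap (f : E →ₗ[R] E') : CharacterModule E' →ₗ[Rᵐᵒᵖ] CharacterModule E where
  toFun c := AddMonoidHom.comp c f.toAddMonoidHom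
  map_add' _ _ := rfl
  map_smul' r c := by ext x; exact congrArg c (f.map_smul (unop r) x).symm

theorem IsShortExact.characterMap {i : E →ₗ[R] E'} {p : E' →ₗ[R] E''} (h : IsShortExact i p) :
    IsShortExact (characterMap p) (characterMap i) where
  inj c c' hc := by
    ext x
    obtain ⟨y, rfl⟩ := h.surj x
    exact DFunLike.congr_fun hc y
  surj c := by
    obtain ⟨c', hc'⟩ := injective_iff_forall_character (v := i.toAddMonoidHom).1 h.inj c
    exact ⟨c', by ext x; exact hc' x⟩
  exact c := by
    refine ⟨fun hc => ?_, ?_⟩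
    · obtain ⟨c', hc'⟩ := (exact_iff_forall_character (u := i.toAddMonoidHom)
        (v := p.toAddMonoidHom) h.exact.apply_apply_eq_zero).1 h.exact c
        fun x => DFunLike.congr_fun hc x
      exact ⟨c', by ext x; exact hc' x⟩
    · rintro ⟨c, rfl⟩
      ext x
      exact (congrArg c (h.exact.apply_apply_eq_zero x)).trans (map_zero c)

/-- The character module of a free module is injective. -/
instance injective_characterModule_finsupp (ι : Type u) :
    Module.Injective Rᵐᵒᵖ (CharacterModule (ι →₀ R)) where
  out X Y _ _ _ _ f hf g := by
    have hext (j : ι) : ∃ c : CharacterModule Y, ∀ x, c (f x) = g x (Finsupp.single j 1) :=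
      injective_iff_forall_character (v := f.toAddMonoidHom).1 hf
        (AddMonoidHom.comp (AddMonoidHom.eval (Finsupp.single j (1 : R))) g.toAddMonoidHom)
    choose c hc using hext
    let h : Y →+ (ι →₀ R) →+ AddCircle (1 : ℚ) := AddMonoidHom.flip <|
      Finsupp.liftAddHom fun j => (AddMonoidHom.compHom (c j)).comp
        ((smulAddHom Rᵐᵒᵖ Y).comp (opAddEquiv (α := R)).toAddMonoidHom)
    have hs (y : Y) (j : ι) (r : R) : h y (Finsupp.single j r) = c j (op r • y) := by
      simp only [h, AddMonoidHom.flip_apply, Finsupp.liftAddHom_apply_single]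
      rfl
    refine ⟨{ toFun := h, map_add' := map_add h, map_smul' := fun s y => ?_ }, fun x => ?_⟩
    · refine Finsupp.addHom_ext fun j r => (hs _ _ _).trans ?_
      change _ = h y (unop s • Finsupp.single j r)
      rw [Finsupp.smul_single, hs, smul_smul]
      rfl
    · refine Finsupp.addHom_ext fun j r => (hs _ _ _).trans ?_
      rw [← map_smul f, hc, map_smul]
      simp [CharacterModule.op_smul_apply]
      rfl

end CharacterDual

namespace NTensor

variable {R : Type u} [Ring R]

section Left

variable {A A' : Type u} [AddCommGroup A] [Module Rᵐᵒᵖ A] [AddCommGroup A'] [Module Rᵐᵒᵖ A']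
  {E : Type u} [AddCommGroup E] [Module R E]

/-- The character of `A ⊗ E` corresponding to a map from `A` to the character module of `E`. -/
def characterOfHom (g : A →ₗ[Rᵐᵒᵖ] CharacterModule E) : CharacterModule (NTensor R A E) :=
  lift (S := R) (A := A) (M := E) (X := AddCircle (1 : ℚ)) g.toAddMonoidHom fun a r m => by
    exact DFunLike.congr_fun (g.map_smul (op r) a) m

theorem characterOfHom_tmul (g : A →ₗ[Rᵐᵒᵖ] CharacterModule E) (a : A) (e : E) :
    characterOfHom g (tmul R a e) = g a e :=
  lift_tmul (S := R) _ _ _ _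

/-- The map from `A` to the character module of `E` corresponding to a character of `A ⊗ E`. -/
def homOfCharacter (c : CharacterModule (NTensor R A E)) : A →ₗ[Rᵐᵒᵖ] CharacterModule E where
  toFun a := AddMonoidHom.mk' (fun e => c (tmul R a e)) fun _ _ => by rw [tmul_add, map_add]
  map_add' a b := by ext e; exact (congrArg c (add_tmul a b e)).trans (map_add c _ _)
  map_smul' r a := by ext e; exact congrArg c (op_smul_tmul a (unop r) e)

theorem lmap_injective_iff (f : A →ₗ[Rᵐᵒᵖ] A') : Function.Injective (lmap E f) ↔
    ∀ g : A →ₗ[Rᵐᵒᵖ] CharacterModule E, ∃ g' : A' →ₗ[Rᵐᵒᵖ] CharacterModule E, g'.comp f = g := by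
  rw [injective_iff_forall_character]
  refine ⟨fun h g => ?_, fun h c => ?_⟩
  · obtain ⟨c', hc'⟩ := h (characterOfHom g)
    refine ⟨homOfCharacter c', ?_⟩
    ext a e
    exact (hc' (tmul R a e)).trans (characterOfHom_tmul g a e)
  · obtain ⟨g', hg'⟩ := h (homOfCharacter c)
    refine ⟨characterOfHom g', fun y => DFunLike.congr_fun (f := AddMonoidHom.comp
      (characterOfHom g') (lmap E f)) (g := c) (addMonoidHom_ext fun a e => ?_) y⟩
    exact (characterOfHom_tmul g' (f a) e).trans
      (DFunLike.congr_fun (DFunLike.congr_fun hg' a) e)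

end Left

section Right

variable {E E' : Type u} [AddCommGroup E] [Module R E] [Module Rᵐᵒᵖᵐᵒᵖ E]
  [AddCommGroup E'] [Module R E'] [Module Rᵐᵒᵖᵐᵒᵖ E']
  {F F' F'' : Type u} [AddCommGroup F] [Module Rᵐᵒᵖ F] [AddCommGroup F'] [Module Rᵐᵒᵖ F']
  [AddCommGroup F''] [Module Rᵐᵒᵖ F'']

/-- The character of `E ⊗ F` corresponding to a map from `F` to the character module of `E`. -/
def characterOfHomRight (hE : ∀ (r : Rᵐᵒᵖ) (e : E), op r • e = unop r • e)
    (g : F →ₗ[Rᵐᵒᵖ] CharacterModule E) : CharacterModule (NTensor Rᵐᵒᵖ E F) :=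
  lift (S := Rᵐᵒᵖ) (A := E) (M := F) (X := AddCircle (1 : ℚ)) (AddMonoidHom.flip g.toAddMonoidHom)
    fun e r x => by
      refine (congrArg (g x) (hE r e)).trans ?_
      exact (DFunLike.congr_fun (g.map_smul r x) e).symm

theorem characterOfHomRight_tmul (hE : ∀ (r : Rᵐᵒᵖ) (e : E), op r • e = unop r • e)
    (g : F →ₗ[Rᵐᵒᵖ] CharacterModule E) (e : E) (x : F) :
    characterOfHomRight hE g (tmul Rᵐᵒᵖ e x) = g x e :=
  lift_tmul (S := Rᵐᵒᵖ) _ _ _ _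

/-- The map from `F` to the character module of `E` corresponding to a character of `E ⊗ F`. -/
def homOfCharacterRight (hE : ∀ (r : Rᵐᵒᵖ) (e : E), op r • e = unop r • e)
    (c : CharacterModule (NTensor Rᵐᵒᵖ E F)) : F →ₗ[Rᵐᵒᵖ] CharacterModule E where
  toFun x := AddMonoidHom.mk' (fun e => c (tmul Rᵐᵒᵖ e x)) fun _ _ => by rw [add_tmul, map_add]
  map_add' a b := by ext e; exact (congrArg c (tmul_add e a b)).trans (map_add c _ _)
  map_smul' r a := by
    ext e
    refine (congrArg c (op_smul_tmul e r a)).symm.trans ?_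
    rw [hE]; rfl

theorem rmap_exact_iff (hE : ∀ (r : Rᵐᵒᵖ) (e : E), op r • e = unop r • e)
    (d : F →ₗ[Rᵐᵒᵖ] F') (d' : F' →ₗ[Rᵐᵒᵖ] F'') (hd : ∀ x, d' (d x) = 0) :
    Function.Exact (rmap E d) (rmap E d') ↔ ∀ g : F' →ₗ[Rᵐᵒᵖ] CharacterModule E, g.comp d = 0 →
      ∃ g' : F'' →ₗ[Rᵐᵒᵖ] CharacterModule E, g'.comp d' = g := by
  have htmul (e : E) : tmul Rᵐᵒᵖ e (0 : F'') = 0 := by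
    have h := tmul_add (S := Rᵐᵒᵖ) e (0 : F'') 0
    rwa [add_zero, left_eq_add] at h
  rw [exact_iff_forall_character fun x => DFunLike.congr_fun
    (f := (rmap E d').comp (rmap E d)) (g := 0) (addMonoidHom_ext fun e x => by simp [hd, htmul]) x]
  refine ⟨fun h g hg => ?_, fun h c hc => ?_⟩
  · obtain ⟨c', hc'⟩ := h (characterOfHomRight hE g) fun x => DFunLike.congr_fun
      (f := AddMonoidHom.comp (characterOfHomRight hE g) (rmap E d)) (g := 0)
      (addMonoidHom_ext fun e x => (characterOfHomRight_tmul hE g e (d x)).trans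
        (DFunLike.congr_fun (DFunLike.congr_fun hg x) e)) x
    refine ⟨homOfCharacterRight hE c', ?_⟩
    ext x e
    exact (hc' (tmul Rᵐᵒᵖ e x)).trans (characterOfHomRight_tmul hE g e x)
  · obtain ⟨g', hg'⟩ := h (homOfCharacterRight hE c) (by ext x e; exact hc (tmul Rᵐᵒᵖ e x))
    refine ⟨characterOfHomRight hE g', fun y => DFunLike.congr_fun (f := AddMonoidHom.comp
      (characterOfHomRight hE g') (rmap E d')) (g := c) (addMonoidHom_ext fun e x => ?_) y⟩
    exact (characterOfHomRight_tmul hE g' e (d' x)).trans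
      (DFunLike.congr_fun (DFunLike.congr_fun hg' x) e)

theorem lmap_injective_iff_right (hE : ∀ (r : Rᵐᵒᵖ) (e : E), op r • e = unop r • e)
    (hE' : ∀ (r : Rᵐᵒᵖ) (e : E'), op r • e = unop r • e)
    (f : E →ₗ[Rᵐᵒᵖᵐᵒᵖ] E') (f' : E →ₗ[R] E') (hf : ∀ e, f e = f' e) :
    Function.Injective (lmap F f) ↔ ∀ g : F →ₗ[Rᵐᵒᵖ] CharacterModule E,
      ∃ g' : F →ₗ[Rᵐᵒᵖ] CharacterModule E', (characterMap f').comp g' = g := by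
  rw [injective_iff_forall_character]
  refine ⟨fun h g => ?_, fun h c => ?_⟩
  · obtain ⟨c', hc'⟩ := h (characterOfHomRight hE g)
    refine ⟨homOfCharacterRight hE' c', ?_⟩
    ext x e
    refine Eq.trans ?_ ((hc' (tmul Rᵐᵒᵖ e x)).trans (characterOfHomRight_tmul hE g e x))
    rw [lmap_tmul, hf]; rfl
  · obtain ⟨g', hg'⟩ := h (homOfCharacterRight hE c)
    refine ⟨characterOfHomRight hE' g', fun y => DFunLike.congr_fun (f := AddMonoidHom.comp
      (characterOfHomRight hE' g') (lmap F f)) (g := c) (addMonoidHom_ext fun e x => ?_) y⟩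
    refine (characterOfHomRight_tmul hE' g' (f e) x).trans ?_
    rw [hf]
    exact DFunLike.congr_fun (DFunLike.congr_fun hg' x) e

end Right

end NTensor

section FlatDimension

variable {R : Type u} [Ring R]

theorem isFlatMod_iff_injective (E : ModuleCat.{u} R) :
    IsFlatMod R E ↔ Module.Injective Rᵐᵒᵖ (CharacterModule E) := by
  refine ⟨fun h => ⟨fun X Y _ _ _ _ f hf g => ?_⟩, fun h X Y _ _ _ _ f hf => ?_⟩
  · obtain ⟨g', hg'⟩ := (NTensor.lmap_injective_iff f).1 (h X Y f hf) g
    exact ⟨g', DFunLike.congr_fun hg'⟩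
  · refine (NTensor.lmap_injective_iff f).2 fun g => ?_
    obtain ⟨g', hg'⟩ := h.out f hf g
    exact ⟨g', LinearMap.ext hg'⟩

theorem NTensor.exists_fg_lmap_eq {E : Type u} [AddCommGroup E] [Module R E]
    (I : Submodule Rᵐᵒᵖ Rᵐᵒᵖ) (x : NTensor R I E) :
    ∃ (J : Submodule Rᵐᵒᵖ Rᵐᵒᵖ) (hJ : J ≤ I) (y : NTensor R J E), J.FG ∧
      NTensor.lmap E (Submodule.inclusion hJ) y = x := by
  have hcomp {J K : Submodule Rᵐᵒᵖ Rᵐᵒᵖ} (hJK : J ≤ K) (hKI : K ≤ I) (y : NTensor R J E) :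
      lmap E (Submodule.inclusion hKI) (lmap E (Submodule.inclusion hJK) y) =
        lmap E (Submodule.inclusion (hJK.trans hKI)) y :=
    DFunLike.congr_fun (f := (lmap E (Submodule.inclusion hKI)).comp
      (lmap E (Submodule.inclusion hJK))) (g := lmap E (Submodule.inclusion (hJK.trans hKI)))
      (addMonoidHom_ext fun _ _ => rfl) y
  induction x using NTensor.induction_on with
  | htmul a e =>
    refine ⟨Submodule.span _ {(a : Rᵐᵒᵖ)}, (Submodule.span_singleton_le_iff_mem _ _).2 a.2,
      tmul R ⟨a, Submodule.mem_span_singleton_self _⟩ e, Submodule.fg_span_singleton _, rfl⟩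
  | hadd x y hx hy =>
    obtain ⟨J, hJ, x, hJfg, rfl⟩ := hx
    obtain ⟨K, hK, y, hKfg, rfl⟩ := hy
    refine ⟨J ⊔ K, sup_le hJ hK, lmap E (Submodule.inclusion le_sup_left) x +
      lmap E (Submodule.inclusion le_sup_right) y, hJfg.sup hKfg, ?_⟩
    rw [map_add, hcomp, hcomp]

theorem injective_characterModule_of_extZero (E : Type u) [AddCommGroup E] [Module R E]
    (h : ∀ I : Submodule Rᵐᵒᵖ Rᵐᵒᵖ, I.FG → ExtZero Rᵐᵒᵖ 1 (Rᵐᵒᵖ ⧸ I) (CharacterModule E)) :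
    Module.Injective Rᵐᵒᵖ (CharacterModule E) := by
  have hfg (I : Submodule Rᵐᵒᵖ Rᵐᵒᵖ) (hI : I.FG) :
      Function.Injective (NTensor.lmap E I.subtype) :=
    (NTensor.lmap_injective_iff _).2 fun g => (isShortExact_mkQ I).exists_extension (h I hI) g
  refine Module.Baer.injective fun I g => ?_
  have hinj : Function.Injective (NTensor.lmap E I.subtype) := by
    refine (injective_iff_map_eq_zero _).2 fun x hx => ?_
    obtain ⟨J, hJ, y, hJfg, rfl⟩ := NTensor.exists_fg_lmap_eq I x
    have hcomp : NTensor.lmap E I.subtype (NTensor.lmap E (Submodule.inclusion hJ) y) =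
        NTensor.lmap E J.subtype y :=
      DFunLike.congr_fun (f := (NTensor.lmap E I.subtype).comp
        (NTensor.lmap E (Submodule.inclusion hJ))) (g := NTensor.lmap E J.subtype)
        (NTensor.addMonoidHom_ext fun _ _ => rfl) y
    rw [(injective_iff_map_eq_zero _).1 (hfg J hJfg) y (hcomp.symm.trans hx), map_zero]
  obtain ⟨g', hg'⟩ := (NTensor.lmap_injective_iff _).1 hinj g
  exact ⟨g', fun x hx => DFunLike.congr_fun hg' ⟨x, hx⟩⟩

theorem extZero_of_flatDimLE {n : ℕ} {E : ModuleCat.{u} R} (h : flatDimLE R n E) (k : ℕ)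
    (M : Type u) [AddCommGroup M] [Module Rᵐᵒᵖ M] :
    ExtZero Rᵐᵒᵖ (n + k + 1) M (CharacterModule E) := by
  induction n generalizing E with
  | zero =>
    have := (isFlatMod_iff_injective E).1 h
    exact extZero_of_injective _
  | succ n ih =>
    obtain ⟨K, F, i, p, hi, hp, hip, hF, hK⟩ := h
    have := (isFlatMod_iff_injective F).1 hF
    have hs : IsShortExact i p := ⟨hi, hp, hip⟩
    rw [show n + 1 + k + 1 = n + k + 1 + 1 by omega]
    exact hs.characterMap.extZero_left_succ (ih hK) (extZero_of_injective _)

theorem flatDimLE_of_extZero {n : ℕ} {E : ModuleCat.{u} R}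
    (h : ∀ I : Submodule Rᵐᵒᵖ Rᵐᵒᵖ, I.FG →
      ExtZero Rᵐᵒᵖ (n + 1) (Rᵐᵒᵖ ⧸ I) (CharacterModule E)) : flatDimLE R n E := by
  induction n generalizing E with
  | zero => exact (isFlatMod_iff_injective E).2 (injective_characterModule_of_extZero E h)
  | succ n ih =>
    obtain ⟨K, i, p, hip⟩ := exists_isShortExact_free R E
    exact ⟨K, ModuleCat.of R (E →₀ R), i, p, hip.inj, hip.surj, hip.exact,
      (isFlatMod_iff_injective _).2 (injective_characterModule_finsupp _),
      ih fun I hI => hip.characterMap.extZero_right (extZero_of_injective _) (h I hI)⟩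

theorem flatDim_le_iff {n : ℕ} {E : ModuleCat.{u} R} :
    flatDim R E ≤ n ↔ ∀ (k : ℕ) (M : Type u) [AddCommGroup M] [Module Rᵐᵒᵖ M],
      ExtZero Rᵐᵒᵖ (n + k + 1) M (CharacterModule E) := by
  refine ⟨fun h k M _ _ => ?_, fun h => ?_⟩
  · obtain ⟨d, ⟨m, rfl, hm⟩, hd⟩ := sInf_lt_iff.1 (h.trans_lt (ENat.natCast_lt_natCast.2 n.lt_succ_self))
    obtain ⟨j, rfl⟩ := Nat.exists_eq_add_of_le (Nat.lt_succ_iff.1 (ENat.natCast_lt_natCast.1 hd))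
    rw [add_assoc m]
    exact extZero_of_flatDimLE hm _ M
  · exact sInf_le ⟨n, rfl, flatDimLE_of_extZero fun I _ => h 0 _⟩

theorem extZero_of_injDimLE {n m : ℕ}
    (h : ∀ E : ModuleCat.{u} R, Module.Injective R E → flatDim R E ≤ n)
    {E : ModuleCat.{u} R} (hE : injDimLE R m E) (k : ℕ) (M : Type u) [AddCommGroup M]
    [Module Rᵐᵒᵖ M] : ExtZero Rᵐᵒᵖ (n + k + 1) M (CharacterModule E) := by
  induction m generalizing E k with
  | zero => exact flatDim_le_iff.1 (h E hE) k M
  | succ m ih =>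
    obtain ⟨I, C, i, p, hi, hp, hip, hI, hC⟩ := hE
    have hs : IsShortExact i p := ⟨hi, hp, hip⟩
    exact hs.characterMap.extZero_right (flatDim_le_iff.1 (h I hI) k M) (ih hC (k + 1))

theorem isFlatMod_mulOpposite_iff (F : ModuleCat.{u} Rᵐᵒᵖ) :
    IsFlatMod Rᵐᵒᵖ F ↔ ∀ (E : Type u) [AddCommGroup E] [Module R E],
      ExtZero Rᵐᵒᵖ 1 F (CharacterModule E) := by
  refine ⟨fun h E _ _ => ?_, fun h A B _ _ _ _ f hf => ?_⟩
  · obtain ⟨K, i, p, hip⟩ := exists_isShortExact_free R E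
    refine hip.characterMap.extZero_one_of_exists_lift (extZero_of_injective 0) ?_
    let e : Rᵐᵒᵖᵐᵒᵖ →+* R := (RingEquiv.opOp R).symm
    let : Module Rᵐᵒᵖᵐᵒᵖ K := Module.compHom K e
    let : Module Rᵐᵒᵖᵐᵒᵖ (E →₀ R) := Module.compHom (E →₀ R) e
    let i' : K →ₗ[Rᵐᵒᵖᵐᵒᵖ] (E →₀ R) :=
      { toFun := i, map_add' := i.map_add, map_smul' := fun r => i.map_smul (e r) }
    exact (NTensor.lmap_injective_iff_right (fun _ _ => rfl) (fun _ _ => rfl) i' i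
      fun _ => rfl).1 (h _ _ i' hip.inj)
  · let e : R →+* Rᵐᵒᵖᵐᵒᵖ := RingEquiv.opOp R
    let : Module R A := Module.compHom A e
    let : Module R B := Module.compHom B e
    let f' : A →ₗ[R] B :=
      { toFun := f, map_add' := f.map_add, map_smul' := fun r => f.map_smul (e r) }
    exact (NTensor.lmap_injective_iff_right (fun _ _ => rfl) (fun _ _ => rfl) f f'
      fun _ => rfl).2 ((isShortExact_range_mkQ f' hf).characterMap.exists_lift (h _))

theorem IsFlatMod.extZero {F : ModuleCat.{u} Rᵐᵒᵖ} (h : IsFlatMod Rᵐᵒᵖ F) (k : ℕ)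
    (E : Type u) [AddCommGroup E] [Module R E] :
    ExtZero Rᵐᵒᵖ (k + 1) F (CharacterModule E) := by
  induction k generalizing E with
  | zero => exact (isFlatMod_mulOpposite_iff F).1 h E
  | succ k ih =>
    obtain ⟨K, i, p, hip⟩ := exists_isShortExact_free R E
    exact hip.characterMap.extZero_left_succ (ih K) (extZero_of_injective _)

end FlatDimension

section GorensteinFlat

attribute [local instance] RingHomInvPair.of_ringEquiv

variable {R : Type u} [Ring R]

/-- `Ext^k(M, D E) = 0` for all positive `k` and all injective left `R`-modules `E` with character
module `D E`,
i.e. `Tor_k(M, E) = 0`. -/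
def TorAcyclic (M : ModuleCat.{u} Rᵐᵒᵖ) : Prop :=
  ∀ (E : Type u) [AddCommGroup E] [Module R E], Module.Injective R E →
    ∀ k, ExtZero Rᵐᵒᵖ (k + 1) M (CharacterModule E)

theorem IsGorensteinFlat.torAcyclic {M : ModuleCat.{u} Rᵐᵒᵖ} (h : IsGorensteinFlat Rᵐᵒᵖ M) :
    TorAcyclic M := by
  obtain ⟨F, d, hF, hd, ⟨e⟩, hdI⟩ := h
  intro E _ _ hE k
  let : Module Rᵐᵒᵖᵐᵒᵖ E := Module.compHom E ((RingEquiv.opOp R).symm : Rᵐᵒᵖᵐᵒᵖ →+* R)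
  have hE' : Module.Injective Rᵐᵒᵖᵐᵒᵖ E :=
    Module.Injective.of_ringEquiv (M := E) (RingEquiv.opOp R)
      { AddEquiv.refl E with map_smul' := fun _ _ => rfl }
  have hse (m : ℤ) : IsShortExact (LinearMap.range (d m)).subtype (d (m + 1)).rangeRestrict := by
    refine ⟨Submodule.injective_subtype _, LinearMap.surjective_rangeRestrict _, fun x => ?_⟩
    rw [← LinearMap.mem_ker, LinearMap.ker_rangeRestrict, LinearMap.mem_ker, hd m x]
    simp
  have hext (k : ℕ) (m : ℤ) :
      ExtZero Rᵐᵒᵖ (k + 1) (LinearMap.range (d m)) (CharacterModule E) := by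
    induction k generalizing m with
    | zero =>
      obtain ⟨m, rfl⟩ : ∃ k : ℤ, m = k + 1 + 1 := ⟨m - 2, by omega⟩
      refine (hse (m + 1)).extZero_one_of_exists_extension ((hF _).extZero 0 E) fun g => ?_
      obtain ⟨g', hg'⟩ := (NTensor.rmap_exact_iff (fun _ _ => rfl) (d m) (d (m + 1))
        (hd m).apply_apply_eq_zero).1 (hdI E hE' m) (g.comp (d (m + 1)).rangeRestrict) (by
          ext1 x
          refine (congrArg g (Subtype.ext ?_)).trans (map_zero g)
          exact (hd m).apply_apply_eq_zero x)
      refine ⟨g', LinearMap.ext ?_⟩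
      rintro ⟨_, x, rfl⟩
      exact DFunLike.congr_fun hg' x
    | succ k ih =>
      obtain ⟨m, rfl⟩ : ∃ k : ℤ, m = k + 1 := ⟨m - 1, by omega⟩
      exact (hse m).extZero_quotient_succ (ih m) ((hF _).extZero (k + 1) E)
  exact (hext k 0).of_linearEquiv e.symm

theorem IsGorensteinFlat.exists_isShortExact {S : Type u} [Ring S] {M : ModuleCat.{u} S}
    (h : IsGorensteinFlat S M) : ∃ (F M' : ModuleCat.{u} S) (i : M →ₗ[S] F) (p : F →ₗ[S] M'),
      IsShortExact i p ∧ IsFlatMod S F ∧ IsGorensteinFlat S M' := by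
  obtain ⟨F, d, hF, hd, ⟨e⟩, hdI⟩ := h
  refine ⟨F (0 + 1), ModuleCat.of S (LinearMap.range (d (0 + 1))),
    (LinearMap.range (d 0)).subtype.comp e.toLinearMap, (d (0 + 1)).rangeRestrict,
    ⟨?_, LinearMap.surjective_rangeRestrict _, fun x => ?_⟩, hF _,
    fun n => F (n + 1), fun n => d (n + 1), fun n => hF _, fun n => hd _,
    ⟨LinearEquiv.refl _ _⟩, fun I _ _ hI n => hdI I hI _⟩
  · exact (Submodule.injective_subtype _).comp e.injective
  · rw [← LinearMap.mem_ker, LinearMap.ker_rangeRestrict, LinearMap.mem_ker, hd 0 x]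
    exact ⟨fun ⟨y, hy⟩ => ⟨e.symm ⟨x, y, hy⟩, by simp⟩, fun ⟨y, hy⟩ => hy ▸ (e y).2⟩

theorem exists_int_chain {α : Type*} {r : α → α → Prop} (hup : ∀ a, ∃ b, r a b)
    (hdown : ∀ a, ∃ b, r b a) (a : α) : ∃ C : ℤ → α, C 1 = a ∧ ∀ n, r (C n) (C (n + 1)) := by
  choose up hup using hup
  choose down hdown using hdown
  let C : ℤ → α
    | Int.ofNat n => up^[n] a
    | Int.negSucc n => down^[n + 1] a
  have hC (n : ℤ) : r (C n) (C (n + 1)) := by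
    match n with
    | Int.ofNat n =>
      change r (up^[n] a) (up^[n + 1] a)
      rw [Function.iterate_succ_apply']
      exact hup _
    | Int.negSucc 0 => exact hdown a
    | Int.negSucc (n + 1) =>
      change r (down^[n + 2] a) (down^[n + 1] a)
      rw [Function.iterate_succ_apply']
      exact hdown _
  refine ⟨fun n => C (n - 1), rfl, fun n => ?_⟩
  change r (C (n - 1)) (C (n + 1 - 1))
  rw [add_sub_right_comm]
  exact hC (n - 1)

theorem IsShortExact.exists_factor {S : Type u} [Ring S] {A B C X : Type u} [AddCommGroup A]
    [Module S A] [AddCommGroup B] [Module S B] [AddCommGroup C] [Module S C] [AddCommGroup X]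
    [Module S X] {i : A →ₗ[S] B} {p : B →ₗ[S] C} (h : IsShortExact i p) (g : B →ₗ[S] X)
    (hg : g.comp i = 0) : ∃ g' : C →ₗ[S] X, g'.comp p = g := by
  refine ⟨((LinearMap.ker p).liftQ g fun x hx => ?_).comp
    (p.quotKerEquivOfSurjective h.surj).symm.toLinearMap, LinearMap.ext fun x => ?_⟩
  · obtain ⟨y, rfl⟩ := (h.exact x).1 hx
    exact DFunLike.congr_fun hg y
  · have : (p.quotKerEquivOfSurjective h.surj).symm (p x) = (LinearMap.ker p).mkQ x := by
      rw [LinearEquiv.symm_apply_eq]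
      rfl
    simp [this]

theorem isGorensteinFlat_of_chain {C F : ℤ → ModuleCat.{u} Rᵐᵒᵖ}
    {i : ∀ n, C n →ₗ[Rᵐᵒᵖ] F n} {p : ∀ n, F n →ₗ[Rᵐᵒᵖ] C (n + 1)}
    (hip : ∀ n, IsShortExact (i n) (p n)) (hF : ∀ n, IsFlatMod Rᵐᵒᵖ (F n))
    (hC : ∀ n, TorAcyclic (C n)) : IsGorensteinFlat Rᵐᵒᵖ (C (0 + 1)) := by
  have hd (n : ℤ) : Function.Exact ((i (n + 1)).comp (p n))
      ((i (n + 1 + 1)).comp (p (n + 1))) := fun x => by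
    rw [LinearMap.comp_apply, map_eq_zero_iff _ (hip _).inj, (hip (n + 1)).exact x]
    constructor
    · rintro ⟨y, rfl⟩
      obtain ⟨z, rfl⟩ := (hip n).surj y
      exact ⟨z, rfl⟩
    · rintro ⟨z, rfl⟩
      exact ⟨_, rfl⟩
  refine ⟨F, fun n => (i (n + 1)).comp (p n), hF, hd, ⟨?_⟩, fun I _ _ hI n => ?_⟩
  · exact (LinearEquiv.ofInjective (i (0 + 1)) (hip _).inj).trans (LinearEquiv.ofEq _ _
      (LinearMap.range_comp_of_range_eq_top _ (LinearMap.range_eq_top.2 (hip 0).surj)).symm)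
  · let : Module R I := Module.compHom I (RingEquiv.opOp R : R →+* Rᵐᵒᵖᵐᵒᵖ)
    have hI' : Module.Injective R I :=
      Module.Injective.of_ringEquiv (M := I) (RingEquiv.opOp R).symm
        { AddEquiv.refl I with map_smul' := fun _ _ => rfl }
    refine (NTensor.rmap_exact_iff (fun _ _ => rfl) _ _ (hd n).apply_apply_eq_zero).2
      fun g hg => ?_
    obtain ⟨g', hg'⟩ := (hip (n + 1)).exists_factor g (LinearMap.ext fun y => by
      obtain ⟨z, rfl⟩ := (hip n).surj y
      exact DFunLike.congr_fun hg z)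
    obtain ⟨f, hf⟩ := (hip (n + 1 + 1)).exists_extension (hC _ I hI' 0) g'
    exact ⟨f, by rw [← LinearMap.comp_assoc, hf, hg']⟩

section Diagrams

variable {S : Type u} [Ring S] {A B C A' C' : Type u} [AddCommGroup A] [Module S A]
  [AddCommGroup B] [Module S B] [AddCommGroup C] [Module S C] [AddCommGroup A'] [Module S A']
  [AddCommGroup C'] [Module S C'] {i : A →ₗ[S] B} {p : B →ₗ[S] C}

theorem IsShortExact.exists_pushout (h : IsShortExact i p) {j : A →ₗ[S] A'} {q : A' →ₗ[S] C'}
    (h' : IsShortExact j q) : ∃ (D : ModuleCat.{u} S) (a : B →ₗ[S] D) (b : D →ₗ[S] C')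
      (c : A' →ₗ[S] D) (e : D →ₗ[S] C), IsShortExact a b ∧ IsShortExact c e := by
  let N := LinearMap.range (i.prod (-j))
  have hN (x : B × A') : N.mkQ x = 0 ↔ ∃ y, i y = x.1 ∧ -j y = x.2 := by
    simp [N, Prod.ext_iff]
  refine ⟨ModuleCat.of S ((B × A') ⧸ N), N.mkQ.comp (LinearMap.inl S B A'),
    N.liftQ (q.comp (LinearMap.snd S B A')) ?_, N.mkQ.comp (LinearMap.inr S B A'),
    N.liftQ (p.comp (LinearMap.fst S B A')) ?_, ⟨?_, ?_, ?_⟩, ⟨?_, ?_, ?_⟩⟩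
  · rintro _ ⟨y, rfl⟩
    simp [h'.exact.apply_apply_eq_zero y]
  · rintro _ ⟨y, rfl⟩
    simp [h.exact.apply_apply_eq_zero y]
  · refine (injective_iff_map_eq_zero _).2 fun x hx => ?_
    obtain ⟨y, hy, hy'⟩ := (hN (x, 0)).1 hx
    rw [(map_eq_zero_iff _ h'.inj).1 (neg_eq_zero.1 hy'), map_zero] at hy
    exact hy.symm
  · exact fun x => (h'.surj x).imp' (fun y => N.mkQ (0, y)) fun _ h => h
  · intro x
    obtain ⟨⟨x, y⟩, rfl⟩ := N.mkQ_surjective x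
    refine ⟨fun hx => ?_, ?_⟩
    · obtain ⟨z, rfl⟩ := (h'.exact y).1 hx
      refine ⟨x + i z, sub_eq_zero.1 ((map_sub N.mkQ (x + i z, 0) (x, j z)).symm.trans ?_)⟩
      exact (hN _).2 ⟨z, by simp⟩
    · rintro ⟨z, hz⟩
      rw [← hz]
      exact map_zero q
  · refine (injective_iff_map_eq_zero _).2 fun x hx => ?_
    obtain ⟨y, hy, hy'⟩ := (hN (0, x)).1 hx
    rw [(map_eq_zero_iff _ h.inj).1 hy, map_zero, neg_zero] at hy'
    exact hy'.symm
  · exact fun x => (h.surj x).imp' (fun y => N.mkQ (y, 0)) fun _ h => h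
  · intro x
    obtain ⟨⟨x, y⟩, rfl⟩ := N.mkQ_surjective x
    refine ⟨fun hx => ?_, ?_⟩
    · obtain ⟨z, rfl⟩ := (h.exact x).1 hx
      refine ⟨y + j z, sub_eq_zero.1 ((map_sub N.mkQ (0, y + j z) (i z, y)).symm.trans ?_)⟩
      exact (hN _).2 ⟨-z, by simp⟩
    · rintro ⟨z, hz⟩
      rw [← hz]
      exact map_zero p

theorem IsShortExact.exists_quotient (h : IsShortExact i p) {j : B →ₗ[S] A'} {q : A' →ₗ[S] C'}
    (h' : IsShortExact j q) : ∃ (D : ModuleCat.{u} S) (a : A →ₗ[S] A') (b : A' →ₗ[S] D)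
      (c : C →ₗ[S] D) (e : D →ₗ[S] C'), IsShortExact a b ∧ IsShortExact c e := by
  have hs := isShortExact_range_mkQ (j.comp i) (h'.inj.comp h.inj)
  obtain ⟨c, hc⟩ := h.exists_factor ((LinearMap.range (j.comp i)).mkQ.comp j)
    (LinearMap.ext fun x => hs.exact.apply_apply_eq_zero x)
  obtain ⟨e, he⟩ := hs.exists_factor q (LinearMap.ext fun x => h'.exact.apply_apply_eq_zero (i x))
  refine ⟨ModuleCat.of S _, _, _, c, e, hs, ⟨?_, fun x => ?_, fun x => ⟨fun hx => ?_, ?_⟩⟩⟩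
  · refine (injective_iff_map_eq_zero _).2 fun x hx => ?_
    obtain ⟨x, rfl⟩ := h.surj x
    obtain ⟨y, hy⟩ := (hs.exact (j x)).1 ((DFunLike.congr_fun hc x).symm.trans hx)
    rw [← h'.inj hy, h.exact.apply_apply_eq_zero]
  · exact (h'.surj x).imp' (Submodule.mkQ _) fun y hy => (DFunLike.congr_fun he y).trans hy
  · obtain ⟨x, rfl⟩ := hs.surj x
    obtain ⟨y, rfl⟩ := (h'.exact x).1 ((DFunLike.congr_fun he x).symm.trans hx)
    exact ⟨p y, DFunLike.congr_fun hc y⟩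
  · rintro ⟨y, rfl⟩
    obtain ⟨y, rfl⟩ := h.surj y
    exact (congrArg e (DFunLike.congr_fun hc y)).trans
      ((DFunLike.congr_fun he (j y)).trans (h'.exact.apply_apply_eq_zero y))

end Diagrams

theorem gflatDimLE.exists_isShortExact (hR : IsGFClosed Rᵐᵒᵖ) {m : ℕ} {K : ModuleCat.{u} Rᵐᵒᵖ}
    (h : gflatDimLE Rᵐᵒᵖ m K) :
    ∃ (H G : ModuleCat.{u} Rᵐᵒᵖ) (i : K →ₗ[Rᵐᵒᵖ] H) (p : H →ₗ[Rᵐᵒᵖ] G), IsShortExact i p ∧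
      IsGorensteinFlat Rᵐᵒᵖ G ∧ ∀ (E : Type u) [AddCommGroup E] [Module R E] (k : ℕ),
        ExtZero Rᵐᵒᵖ (m + k + 1) H (CharacterModule E) := by
  induction m generalizing K with
  | zero =>
    obtain ⟨F, G, i, p, hip, hF, hG⟩ := IsGorensteinFlat.exists_isShortExact h
    exact ⟨F, G, i, p, hip, hG, fun E _ _ k => hF.extZero _ E⟩
  | succ m ih =>
    obtain ⟨L, G, i, p, hi, hp, hip, hG, hL⟩ := h
    obtain ⟨H, G', j, q, hjq, hG', hH⟩ := ih hL
    obtain ⟨D, a, b, c, e, hab, hce⟩ := IsShortExact.exists_pushout ⟨hi, hp, hip⟩ hjq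
    obtain ⟨F, D', f, g, hfg, hF, hD'⟩ :=
      (hR G D G' a b hab.inj hab.surj hab.exact hG hG').exists_isShortExact
    obtain ⟨Q, s, t, v, w, hst, hvw⟩ := hce.exists_quotient hfg
    refine ⟨Q, D', v, w, hvw, hD', fun E _ _ k => ?_⟩
    rw [show m + 1 + k + 1 = m + k + 1 + 1 by omega]
    exact hst.extZero_quotient_succ (hH E k) (hF.extZero _ E)

theorem exists_injective_isShortExact (A : Type u) [AddCommGroup A] [Module R A] :
    ∃ (E C : ModuleCat.{u} R) (i : A →ₗ[R] E) (p : E →ₗ[R] C), IsShortExact i p ∧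
      Module.Injective R E := by
  obtain ⟨⟨J, hJ, f, hf⟩⟩ :=
    CategoryTheory.EnoughInjectives.presentation (ModuleCat.of R A)
  exact ⟨J, ModuleCat.of R _, f.hom, _,
    isShortExact_range_mkQ f.hom ((ModuleCat.mono_iff_injective f).1 hf),
    Module.injective_module_of_injective_object R J⟩

theorem TorAcyclic.isFlatMod {H : ModuleCat.{u} Rᵐᵒᵖ} (h : TorAcyclic H) {m : ℕ}
    (hm : ∀ (E : Type u) [AddCommGroup E] [Module R E] (k : ℕ),
      ExtZero Rᵐᵒᵖ (m + k + 1) H (CharacterModule E)) : IsFlatMod Rᵐᵒᵖ H := by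
  induction m with
  | zero => exact (isFlatMod_mulOpposite_iff H).2 fun E _ _ => by simpa using hm E 0
  | succ m ih =>
    refine ih fun A _ _ k => ?_
    obtain ⟨E, C, i, p, hip, hE⟩ := exists_injective_isShortExact (R := R) A
    refine hip.characterMap.extZero_right (h E hE _) ?_
    rw [show m + k + 1 + 1 = m + 1 + k + 1 by omega]
    exact hm C k

theorem isFlatMod_finsupp (ι : Type u) :
    IsFlatMod Rᵐᵒᵖ (ModuleCat.of Rᵐᵒᵖ (ι →₀ Rᵐᵒᵖ)) :=
  (isFlatMod_mulOpposite_iff _).2 fun _ _ _ => extZero_of_projective 0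

theorem TorAcyclic.isGorensteinFlat (hR : IsGFClosed Rᵐᵒᵖ)
    (hfin : ∀ M : ModuleCat.{u} Rᵐᵒᵖ, ∃ m, gflatDimLE Rᵐᵒᵖ m M) {M : ModuleCat.{u} Rᵐᵒᵖ}
    (h : TorAcyclic M) : IsGorensteinFlat Rᵐᵒᵖ M := by
  let r (M N : {M : ModuleCat.{u} Rᵐᵒᵖ // TorAcyclic M}) : Prop :=
    ∃ (F : ModuleCat.{u} Rᵐᵒᵖ) (i : M.1 →ₗ[Rᵐᵒᵖ] F) (p : F →ₗ[Rᵐᵒᵖ] N.1), IsShortExact i p ∧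
      IsFlatMod Rᵐᵒᵖ F
  obtain ⟨C, hCM, hC⟩ := exists_int_chain (r := r) (fun ⟨M, hM⟩ => by
    obtain ⟨m, hm⟩ := hfin M
    obtain ⟨H, G, i, p, hip, hG, hH⟩ := hm.exists_isShortExact hR
    have hacyclic : TorAcyclic H := fun E _ _ hE k =>
      hip.extZero_middle (hM E hE k) (hG.torAcyclic E hE k)
    exact ⟨⟨G, hG.torAcyclic⟩, H, i, p, hip, hacyclic.isFlatMod hH⟩) (fun ⟨M, hM⟩ => by
    obtain ⟨K, i, p, hip⟩ := exists_isShortExact_free Rᵐᵒᵖ M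
    exact ⟨⟨K, fun E _ _ hE k => hip.extZero_sub (extZero_of_projective k) (hM E hE (k + 1))⟩,
      _, i, p, hip, isFlatMod_finsupp M⟩) ⟨M, h⟩
  choose F i p hip hF using hC
  have := isGorensteinFlat_of_chain (C := fun n => (C n).1) hip hF fun n => (C n).2
  rwa [zero_add, hCM] at this

theorem gflatDimLE_of_extZero (hR : IsGFClosed Rᵐᵒᵖ)
    (hfin : ∀ M : ModuleCat.{u} Rᵐᵒᵖ, ∃ m, gflatDimLE Rᵐᵒᵖ m M) {n : ℕ}
    {M : ModuleCat.{u} Rᵐᵒᵖ}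
    (h : ∀ (E : Type u) [AddCommGroup E] [Module R E], Module.Injective R E →
      ∀ k, ExtZero Rᵐᵒᵖ (n + k + 1) M (CharacterModule E)) : gflatDimLE Rᵐᵒᵖ n M := by
  induction n generalizing M with
  | zero =>
    refine TorAcyclic.isGorensteinFlat hR hfin fun E _ _ hE k => ?_
    simpa using h E hE k
  | succ n ih =>
    obtain ⟨K, i, p, hip⟩ := exists_isShortExact_free Rᵐᵒᵖ M
    refine ⟨K, ModuleCat.of Rᵐᵒᵖ (M →₀ Rᵐᵒᵖ), i, p, hip.inj, hip.surj, hip.exact,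
      TorAcyclic.isGorensteinFlat hR hfin fun E _ _ _ k => extZero_of_projective k,
      ih fun E _ _ hE k => hip.extZero_sub (extZero_of_projective _) ?_⟩
    rw [show n + k + 1 + 1 = n + 1 + k + 1 by omega]
    exact h E hE k

theorem gflatDimLE.extZero {n : ℕ} {M : ModuleCat.{u} Rᵐᵒᵖ} (h : gflatDimLE Rᵐᵒᵖ n M)
    (E : Type u) [AddCommGroup E] [Module R E] (hE : Module.Injective R E) (k : ℕ) :
    ExtZero Rᵐᵒᵖ (n + k + 1) M (CharacterModule E) := by
  induction n generalizing M with
  | zero => exact IsGorensteinFlat.torAcyclic h E hE _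
  | succ n ih =>
    obtain ⟨K, G, i, p, hi, hp, hip, hG, hK⟩ := h
    have hs : IsShortExact i p := ⟨hi, hp, hip⟩
    rw [show n + 1 + k + 1 = n + k + 1 + 1 by omega]
    exact hs.extZero_quotient_succ (ih hK) (hG.torAcyclic E hE _)

theorem extZero_of_gflatDim_le {n : ℕ} {M : ModuleCat.{u} Rᵐᵒᵖ} (h : gflatDim Rᵐᵒᵖ M ≤ n)
    (E : Type u) [AddCommGroup E] [Module R E] (hE : Module.Injective R E) :
    ExtZero Rᵐᵒᵖ (n + 1) M (CharacterModule E) := by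
  obtain ⟨d, ⟨m, rfl, hm⟩, hd⟩ :=
    sInf_lt_iff.1 (h.trans_lt (ENat.natCast_lt_natCast.2 n.lt_succ_self))
  obtain ⟨j, rfl⟩ := Nat.exists_eq_add_of_le (Nat.lt_succ_iff.1 (ENat.natCast_lt_natCast.1 hd))
  exact hm.extZero E hE j

end GorensteinFlat

/-- **Lemma 2.5.**  If `R` is a right GF-closed ring with `r.Gwdim(R) < ∞` and `n` is a
positive integer, then the following are equivalent: (1) `r.Gwdim(R) ≤ n`;
(2) `Gfd_R(M) ≤ n` for every finitely presented right `R`-module `M`;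
(3) `Gfd_R(R/I) ≤ n` for every finitely generated right ideal `I` of `R`;
(4) `fd_R(E) ≤ n` for every injective left `R`-module `E`;
(5) `fd_R(E') ≤ n` for every left `R`-module `E'` of finite injective dimension.
(Right `R`-modules are left `Rᵐᵒᵖ`-modules, and a right ideal of `R` is a left ideal of
`Rᵐᵒᵖ`.) -/
theorem rightGorensteinWeakGlobalDim_le_tfae (R : Type u) [Ring R]
    (h : IsGFClosed Rᵐᵒᵖ) (hfin : gorensteinWeakGlobalDim Rᵐᵒᵖ ≠ ⊤) (n : ℕ) (hn : 0 < n) :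
    List.TFAE
      [gorensteinWeakGlobalDim Rᵐᵒᵖ ≤ (n : ℕ∞),
       ∀ M : ModuleCat.{u} Rᵐᵒᵖ, IsFinitelyPresented Rᵐᵒᵖ M → gflatDim Rᵐᵒᵖ M ≤ (n : ℕ∞),
       ∀ I : Submodule Rᵐᵒᵖ Rᵐᵒᵖ, I.FG →
         gflatDim Rᵐᵒᵖ (ModuleCat.of Rᵐᵒᵖ (Rᵐᵒᵖ ⧸ I)) ≤ (n : ℕ∞),
       ∀ E : ModuleCat.{u} R, Module.Injective R ↥E → flatDim R E ≤ (n : ℕ∞),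
       ∀ E' : ModuleCat.{u} R, injDim R E' ≠ ⊤ → flatDim R E' ≤ (n : ℕ∞)] := by
  have hdim (M : ModuleCat.{u} Rᵐᵒᵖ) : ∃ m, gflatDimLE Rᵐᵒᵖ m M := by
    obtain ⟨d, ⟨m, -, hm⟩, -⟩ := sInf_lt_iff.1
      ((le_iSup (gflatDim Rᵐᵒᵖ) M).trans_lt (lt_top_iff_ne_top.2 hfin))
    exact ⟨m, hm⟩
  tfae_have 1 → 2 := fun h₁ M _ => (le_iSup (gflatDim Rᵐᵒᵖ) M).trans h₁
  tfae_have 2 → 3 := fun h₂ I hI =>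
    h₂ _ (Module.finitePresentation_of_free_of_surjective I.mkQ I.mkQ_surjective
      (by rwa [Submodule.ker_mkQ]))
  tfae_have 3 → 4 := fun h₃ E hE =>
    sInf_le ⟨n, rfl, flatDimLE_of_extZero fun I hI => extZero_of_gflatDim_le (h₃ I hI) E hE⟩
  tfae_have 4 → 5 := fun h₄ E hE => by
    obtain ⟨d, ⟨m, -, hm⟩, -⟩ := sInf_lt_iff.1 (lt_top_iff_ne_top.2 hE)
    exact flatDim_le_iff.2 fun k M _ _ => extZero_of_injDimLE h₄ hm k M
  tfae_have 5 → 4 := fun h₅ E hE =>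
    h₅ E (ne_top_of_le_ne_top (ENat.natCast_ne_top 0) (sInf_le ⟨0, rfl, hE⟩))
  tfae_have 4 → 1 := fun h₄ => iSup_le fun M => sInf_le ⟨n, rfl,
    gflatDimLE_of_extZero h hdim fun E _ _ hE k =>
      flatDim_le_iff.1 (h₄ (ModuleCat.of R E) hE) k M⟩
  tfae_finish
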